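/- arXiv:2510.13225 — 2 statements merged into one kernel-verified Lean document; each statement's English description precedes it below -/
import Mathlib

section
/- Let C be a skeletally small triangulated category, H a Q-subspace of G(C)_Q, and let I(H) be the set of dense triangulated subcategories D of C with image(δ^D_Q) = H, partially ordered by inclusion. Then I(H) is nonempty and has a maximal element with respect to inclusion; moreover every chain in I(H) has an upper bound in I(H), namely its union. -/
open CategoryTheory CategoryTheory.Limits CategoryTheory.Pretriangulated
open scoped TensorProduct

universe v u

set_option linter.unusedSectionVars false
set_option linter.unusedVariables false

namespace GrothendieckPaper

variable (C : Type u) [Category.{v} C] [Preadditive C] [Limits.HasZeroObject C]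
  [HasShift C ℤ] [∀ n : ℤ, (shiftFunctor C n).Additive] [Pretriangulated C]

/-- The set of Euler relations `[V] - [U] - [W]` coming from distinguished triangles
`U ⟶ V ⟶ W ⟶ U⟦1⟧`. -/
def eulerSet : Set (FreeAbelianGroup C) :=
  { x | ∃ T : Triangle C, (T ∈ distTriang C) ∧
      x = FreeAbelianGroup.of T.obj₂ - FreeAbelianGroup.of T.obj₁ - FreeAbelianGroup.of T.obj₃ }

def eulerSubgroup : AddSubgroup (FreeAbelianGroup C) := AddSubgroup.closure (eulerSet C)

/-- The Grothendieck group of a (skeletally small) triangulated category. -/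
def G : Type u := FreeAbelianGroup C ⧸ eulerSubgroup C

instance : AddCommGroup (G C) := QuotientAddGroup.Quotient.addCommGroup _

/-- The class `[U]` of an object `U` in the Grothendieck group. -/
def cls (U : C) : G C := QuotientAddGroup.mk (FreeAbelianGroup.of U)

/-- A (strictly full) triangulated subcategory of `C`, given by its set of objects:
closed under isomorphisms, under the shifts `[1]` and `[-1]`, and under extensions
(cones): if `X ⟶ Y ⟶ Z ⟶ X⟦1⟧` is distinguished and `X, Y` belong then so does `Z`. -/
structure IsTriangulatedSubcat (S : Set C) : Prop where
  mem_of_iso : ∀ {X Y : C}, (X ≅ Y) → Y ∈ S → X ∈ S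
  shift_mem : ∀ {X : C}, X ∈ S → ((shiftFunctor C (1 : ℤ)).obj X) ∈ S
  shift_neg_mem : ∀ {X : C}, X ∈ S → ((shiftFunctor C (-1 : ℤ)).obj X) ∈ S
  ext_mem : ∀ (T : Triangle C), (T ∈ distTriang C) → T.obj₁ ∈ S → T.obj₂ ∈ S → T.obj₃ ∈ S

/-- `npowAux U n` is the direct sum of `n + 1` copies of `U`. -/
noncomputable def npowAux (U : C) : ℕ → C
  | 0 => U
  | n + 1 => U ⊞ npowAux U n

/-- `npow U n` is the direct sum `U^n` of `n` copies of `U` (for `n ≥ 1`;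
`npow U 0` is defined to be `U` as a junk value). -/
noncomputable def npow (U : C) (n : ℕ) : C := npowAux C U (n - 1)

/-- A subcategory (set of objects) `S` is dense in `C` if every object of `C` is a
direct summand of an object of `S`. -/
def DenseSub (S : Set C) : Prop := ∀ U : C, ∃ V : C, (U ⊞ V) ∈ S

/-- A subcategory `S` is radical if `U^n ∈ S` for some `n ≥ 1` implies `U ∈ S`. -/
def RadicalSub (S : Set C) : Prop := ∀ (U : C) (n : ℕ), 1 ≤ n → npow C U n ∈ S → U ∈ S

/-- `√S = { U | U^n ∈ S for some n ≥ 1 }`. -/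
def sqrtSet (S : Set C) : Set C := { U : C | ∃ n : ℕ, 1 ≤ n ∧ npow C U n ∈ S }

lemma subset_sqrtSet (S : Set C) : S ⊆ sqrtSet C S := fun U hU => ⟨1, le_refl 1, hU⟩

/-- The Euler relations for the full subcategory on `S`, coming from distinguished
triangles of `C` all of whose vertices lie in `S`. -/
def eulerSetSub (S : Set C) : Set (FreeAbelianGroup S) :=
  { x | ∃ (T : Triangle C) (_ : T ∈ distTriang C) (h1 : T.obj₁ ∈ S) (h2 : T.obj₂ ∈ S)
      (h3 : T.obj₃ ∈ S),
      x = FreeAbelianGroup.of (⟨T.obj₂, h2⟩ : S) - FreeAbelianGroup.of ⟨T.obj₁, h1⟩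
        - FreeAbelianGroup.of ⟨T.obj₃, h3⟩ }

/-- The Grothendieck group of the triangulated subcategory on the set of objects `S`. -/
def GSub (S : Set C) : Type u := FreeAbelianGroup S ⧸ AddSubgroup.closure (eulerSetSub C S)

instance (S : Set C) : AddCommGroup (GSub C S) := QuotientAddGroup.Quotient.addCommGroup _

lemma delta_le (S : Set C) :
    AddSubgroup.closure (eulerSetSub C S) ≤
      (eulerSubgroup C).comap (FreeAbelianGroup.map (Subtype.val : S → C)) := by
  rw [AddSubgroup.closure_le]
  rintro x ⟨T, hT, h1, h2, h3, rfl⟩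
  simp only [SetLike.mem_coe, AddSubgroup.mem_comap, map_sub, FreeAbelianGroup.map_of_apply]
  exact AddSubgroup.subset_closure ⟨T, hT, rfl⟩

/-- The natural map `δ^S : G(S) → G(C)` induced by the inclusion of the subcategory. -/
def deltaHom (S : Set C) : GSub C S →+ G C :=
  QuotientAddGroup.map _ _ (FreeAbelianGroup.map (Subtype.val : S → C)) (delta_le C S)

lemma incl_le {S S' : Set C} (h : S ⊆ S') :
    AddSubgroup.closure (eulerSetSub C S) ≤
      (AddSubgroup.closure (eulerSetSub C S')).comap
        (FreeAbelianGroup.map (Set.inclusion h)) := by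
  rw [AddSubgroup.closure_le]
  rintro x ⟨T, hT, h1, h2, h3, rfl⟩
  simp only [SetLike.mem_coe, AddSubgroup.mem_comap, map_sub, FreeAbelianGroup.map_of_apply]
  exact AddSubgroup.subset_closure ⟨T, hT, h h1, h h2, h h3, rfl⟩

/-- The map `G(S) → G(S')` induced by an inclusion `S ⊆ S'` of subcategories. -/
def inclHom {S S' : Set C} (h : S ⊆ S') : GSub C S →+ GSub C S' :=
  QuotientAddGroup.map _ _ (FreeAbelianGroup.map (Set.inclusion h)) (incl_le C h)

/-- `δ^S ⊗ ℚ : G(S)_ℚ → G(C)_ℚ`. -/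
noncomputable def deltaQ (S : Set C) : ℚ ⊗[ℤ] GSub C S →ₗ[ℚ] ℚ ⊗[ℤ] G C :=
  LinearMap.baseChange ℚ (deltaHom C S).toIntLinearMap

/-- The rationalization of the map induced by an inclusion of subcategories. -/
noncomputable def inclQ {S S' : Set C} (h : S ⊆ S') :
    ℚ ⊗[ℤ] GSub C S →ₗ[ℚ] ℚ ⊗[ℤ] GSub C S' :=
  LinearMap.baseChange ℚ (inclHom C h).toIntLinearMap

/-- The collection `I(H)` of dense triangulated subcategories `S` of `C` with
`image(δ^S_ℚ) = H`. -/
def denseFamily (H : Submodule ℚ (ℚ ⊗[ℤ] G C)) : Set (Set C) :=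
  { S | IsTriangulatedSubcat C S ∧ DenseSub C S ∧ LinearMap.range (deltaQ C S) = H }

section

open scoped ZeroObject

lemma cls_obj₂ (T : Triangle C) (hT : T ∈ distTriang C) :
    cls C T.obj₂ = cls C T.obj₁ + cls C T.obj₃ := by
  have h : (QuotientAddGroup.mk (FreeAbelianGroup.of T.obj₂ - FreeAbelianGroup.of T.obj₁
      - FreeAbelianGroup.of T.obj₃) : FreeAbelianGroup C ⧸ eulerSubgroup C) = 0 :=
    (QuotientAddGroup.eq_zero_iff _).2 (AddSubgroup.subset_closure ⟨T, hT, rfl⟩)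
  have h' : cls C T.obj₂ - cls C T.obj₁ - cls C T.obj₃ = 0 := h
  rwa [sub_sub, sub_eq_zero] at h'

lemma cls_zero : cls C (0 : C) = 0 := by
  have h : cls C (0 : C) = cls C (0 : C) + cls C (0 : C) :=
    cls_obj₂ C _ (contractible_distinguished (0 : C))
  simpa using h

lemma cls_eq_of_iso {X Y : C} (e : X ≅ Y) : cls C X = cls C Y := by
  have hT : Triangle.mk e.hom (0 : Y ⟶ 0) 0 ∈ distTriang C :=
    isomorphic_distinguished _ (contractible_distinguished X) _
      (Triangle.isoMk _ _ (Iso.refl X) e.symm (Iso.refl (0 : C))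
        (e.hom_inv_id.trans (Category.comp_id _).symm)
        (zero_comp.trans comp_zero.symm) (zero_comp.trans comp_zero.symm))
  have h : cls C Y = cls C X + cls C (0 : C) := cls_obj₂ C _ hT
  rw [h, cls_zero, add_zero]

lemma cls_shift (X : C) : cls C (X⟦(1 : ℤ)⟧) = - cls C X := by
  have h : cls C (0 : C) = cls C X + cls C (X⟦(1 : ℤ)⟧) :=
    cls_obj₂ C _ (rot_of_distTriang _ (contractible_distinguished X))
  rw [cls_zero] at h
  exact (neg_eq_of_add_eq_zero_right h.symm).symm

lemma cls_shift_neg (X : C) : cls C (X⟦(-1 : ℤ)⟧) = - cls C X := by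
  have e : (X⟦(-1 : ℤ)⟧)⟦(1 : ℤ)⟧ ≅ X := shiftNegShift X (1 : ℤ)
  rw [← cls_eq_of_iso C e, cls_shift, neg_neg]

lemma cls_biprod (X Y : C) : cls C (X ⊞ Y) = cls C X + cls C Y :=
  cls_obj₂ C _ (binaryBiproductTriangle_distinguished X Y)

lemma cls_surjective : Function.Surjective (cls C) := by
  intro g
  obtain ⟨x, rfl⟩ := QuotientAddGroup.mk_surjective g
  induction x using FreeAbelianGroup.induction_on with
  | zero => exact ⟨0, cls_zero C⟩
  | of X => exact ⟨X, rfl⟩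
  | neg X _ => exact ⟨X⟦(1 : ℤ)⟧, cls_shift C X⟩
  | add x y hx hy =>
    obtain ⟨X, hX⟩ := hx
    obtain ⟨Y, hY⟩ := hy
    exact ⟨X ⊞ Y, by rw [cls_biprod, hX, hY]; rfl⟩

end

/-- The class of an object in the rationalized Grothendieck group. -/
noncomputable def clsQ (U : C) : ℚ ⊗[ℤ] G C := 1 ⊗ₜ[ℤ] cls C U

lemma range_deltaQ (S : Set C) :
    LinearMap.range (deltaQ C S) = Submodule.span ℚ (clsQ C '' S) := by
  apply le_antisymm
  · rintro _ ⟨x, rfl⟩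
    induction x using TensorProduct.induction_on with
    | zero => simp
    | add x y hx hy => rw [map_add]; exact add_mem hx hy
    | tmul q g =>
      have hq : deltaQ C S (q ⊗ₜ g) = q • ((1 : ℚ) ⊗ₜ[ℤ] deltaHom C S g) := by
        simp [deltaQ, TensorProduct.smul_tmul']
      rw [hq]
      clear hq
      refine Submodule.smul_mem _ _ ?_
      obtain ⟨x, rfl⟩ := QuotientAddGroup.mk_surjective g
      change (1 : ℚ) ⊗ₜ[ℤ] (QuotientAddGroup.mk (FreeAbelianGroup.map Subtype.val x) : G C) ∈ _
      let f : FreeAbelianGroup S →+ ℚ ⊗[ℤ] G C :=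
        (TensorProduct.mk ℤ ℚ (G C) 1).toAddMonoidHom.comp
          ((QuotientAddGroup.mk' (eulerSubgroup C)).comp (FreeAbelianGroup.map Subtype.val))
      change f x ∈ _
      have hf (U : S) : f (FreeAbelianGroup.of U) = clsQ C U := by
        change (1 : ℚ) ⊗ₜ[ℤ] (QuotientAddGroup.mk
          (FreeAbelianGroup.map Subtype.val (FreeAbelianGroup.of U)) : G C) = _
        rw [FreeAbelianGroup.map_of_apply]
        rfl
      have hmem (U : S) : f (FreeAbelianGroup.of U) ∈ Submodule.span ℚ (clsQ C '' S) :=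
        hf U ▸ Submodule.subset_span ⟨U, U.2, rfl⟩
      induction x using FreeAbelianGroup.induction_on with
      | zero => rw [map_zero]; exact zero_mem _
      | of U => exact hmem U
      | neg U _ => rw [map_neg]; exact neg_mem (hmem U)
      | add x y hx hy => rw [map_add]; exact add_mem hx hy
  · rw [Submodule.span_le]
    rintro _ ⟨U, hU, rfl⟩
    refine ⟨1 ⊗ₜ (QuotientAddGroup.mk (FreeAbelianGroup.of (⟨U, hU⟩ : S)) : GSub C S), ?_⟩
    change (1 : ℚ) ⊗ₜ[ℤ] (QuotientAddGroup.mk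
      (FreeAbelianGroup.map Subtype.val (FreeAbelianGroup.of (⟨U, hU⟩ : S))) : G C) = _
    rw [FreeAbelianGroup.map_of_apply]
    rfl

/-- The objects of `C` whose rational class lies in `H`. -/
def objectsOver (H : Submodule ℚ (ℚ ⊗[ℤ] G C)) : Set C := { U | clsQ C U ∈ H }

lemma isTriangulatedSubcat_objectsOver (H : Submodule ℚ (ℚ ⊗[ℤ] G C)) :
    IsTriangulatedSubcat C (objectsOver C H) where
  mem_of_iso e hY := by
    simpa only [objectsOver, Set.mem_ofPred_eq, clsQ, cls_eq_of_iso C e] using hY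
  shift_mem {X} hX := by
    simpa only [objectsOver, Set.mem_ofPred_eq, clsQ, cls_shift, TensorProduct.tmul_neg,
      neg_mem_iff] using hX
  shift_neg_mem {X} hX := by
    simpa only [objectsOver, Set.mem_ofPred_eq, clsQ, cls_shift_neg, TensorProduct.tmul_neg,
      neg_mem_iff] using hX
  ext_mem T hT h₁ h₂ := by
    have h : clsQ C T.obj₂ = clsQ C T.obj₁ + clsQ C T.obj₃ := by
      rw [clsQ, cls_obj₂ C T hT, TensorProduct.tmul_add]
      rfl
    exact (H.add_mem_iff_right h₁).1 (h ▸ h₂)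

lemma denseSub_objectsOver (H : Submodule ℚ (ℚ ⊗[ℤ] G C)) : DenseSub C (objectsOver C H) :=
  fun U ↦ ⟨U⟦(1 : ℤ)⟧, by
    simp [objectsOver, clsQ, cls_biprod, cls_shift]⟩

lemma range_deltaQ_objectsOver (H : Submodule ℚ (ℚ ⊗[ℤ] G C)) :
    LinearMap.range (deltaQ C (objectsOver C H)) = H := by
  rw [range_deltaQ]
  apply le_antisymm
  · rw [Submodule.span_le]
    rintro _ ⟨U, hU, rfl⟩
    exact hU
  · intro h hh
    obtain ⟨⟨g, n⟩, hn⟩ := IsLocalizedModule.surj (nonZeroDivisors ℤ)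
      (TensorProduct.mk ℤ ℚ (G C) 1) h
    obtain ⟨U, rfl⟩ := cls_surjective C g
    have hn' : ((n : ℤ) : ℚ) • h = clsQ C U := by
      rw [Int.cast_smul_eq_zsmul]
      exact hn
    have hn0 : ((n : ℤ) : ℚ) ≠ 0 := Int.cast_ne_zero.2 (nonZeroDivisors.coe_ne_zero n)
    have hU : clsQ C U ∈ H := hn' ▸ H.smul_mem _ hh
    rw [← Submodule.smul_mem_iff _ hn0, hn']
    exact Submodule.subset_span ⟨U, hU, rfl⟩

lemma objectsOver_mem_denseFamily (H : Submodule ℚ (ℚ ⊗[ℤ] G C)) :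
    objectsOver C H ∈ denseFamily C H :=
  ⟨isTriangulatedSubcat_objectsOver C H, denseSub_objectsOver C H, range_deltaQ_objectsOver C H⟩

lemma subset_objectsOver {H : Submodule ℚ (ℚ ⊗[ℤ] G C)} {S : Set C} (hS : S ∈ denseFamily C H) :
    S ⊆ objectsOver C H := fun U hU ↦ by
  have h : clsQ C U ∈ LinearMap.range (deltaQ C S) := by
    rw [range_deltaQ]
    exact Submodule.subset_span ⟨U, hU, rfl⟩
  exact hS.2.2 ▸ h

lemma isTriangulatedSubcat_sUnion {c : Set (Set C)} (hc : IsChain (· ⊆ ·) c)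
    (h : ∀ S ∈ c, IsTriangulatedSubcat C S) : IsTriangulatedSubcat C (⋃₀ c) where
  mem_of_iso := by
    rintro X Y e ⟨S, hS, hY⟩
    exact ⟨S, hS, (h S hS).mem_of_iso e hY⟩
  shift_mem := by
    rintro X ⟨S, hS, hX⟩
    exact ⟨S, hS, (h S hS).shift_mem hX⟩
  shift_neg_mem := by
    rintro X ⟨S, hS, hX⟩
    exact ⟨S, hS, (h S hS).shift_neg_mem hX⟩
  ext_mem := by
    rintro T hT ⟨S₁, hS₁, h₁⟩ ⟨S₂, hS₂, h₂⟩
    rcases hc.total hS₁ hS₂ with hle | hle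
    · exact ⟨S₂, hS₂, (h S₂ hS₂).ext_mem T hT (hle h₁) h₂⟩
    · exact ⟨S₁, hS₁, (h S₁ hS₁).ext_mem T hT h₁ (hle h₂)⟩

lemma sUnion_mem_denseFamily {H : Submodule ℚ (ℚ ⊗[ℤ] G C)} {c : Set (Set C)}
    (hcH : c ⊆ denseFamily C H) (hc : IsChain (· ⊆ ·) c) (hne : c.Nonempty) :
    ⋃₀ c ∈ denseFamily C H := by
  obtain ⟨S, hS⟩ := hne
  refine ⟨isTriangulatedSubcat_sUnion C hc fun S hS ↦ (hcH hS).1, fun U ↦ ?_, ?_⟩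
  · obtain ⟨V, hV⟩ := (hcH hS).2.1 U
    exact ⟨V, S, hS, hV⟩
  · apply le_antisymm
    · rw [range_deltaQ, Submodule.span_le]
      rintro _ ⟨U, ⟨S', hS', hU⟩, rfl⟩
      exact subset_objectsOver C (hcH hS') hU
    · rw [← (hcH hS).2.2, range_deltaQ, range_deltaQ]
      exact Submodule.span_mono (Set.image_mono (Set.subset_sUnion_of_mem hS))

/-- `I(H)` is nonempty, has a maximal element with respect to inclusion, and
every nonempty chain in `I(H)` has an upper bound in `I(H)`, namely its union. -/
theorem denseFamily_nonempty_and_has_maximal (H : Submodule ℚ (ℚ ⊗[ℤ] G C)) :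
    (denseFamily C H).Nonempty ∧
    (∃ S ∈ denseFamily C H, ∀ S' ∈ denseFamily C H, S ⊆ S' → S' = S) ∧
    (∀ c ⊆ denseFamily C H, IsChain (· ⊆ ·) c → c.Nonempty →
      (⋃₀ c ∈ denseFamily C H ∧ ∀ S ∈ c, S ⊆ ⋃₀ c)) := by
  have hmem := objectsOver_mem_denseFamily C H
  exact ⟨⟨_, hmem⟩,
    ⟨_, hmem, fun S' hS' hle ↦ (subset_objectsOver C hS').antisymm hle⟩,
    fun c hcH hc hne ↦ ⟨sUnion_mem_denseFamily C hcH hc hne, fun S hS ↦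
      Set.subset_sUnion_of_mem hS⟩⟩


end GrothendieckPaper
end

section
/- Let C be a skeletally small triangulated category and let D be a radical dense subcategory of C. If U is an object of C whose class [U] is a torsion element of G(C), then U belongs to D. -/
open CategoryTheory CategoryTheory.Limits CategoryTheory.Pretriangulated
open scoped TensorProduct

universe v u

set_option linter.unusedSectionVars false
set_option linter.unusedVariables false

namespace GrothendieckPaper

variable (C : Type u) [Category.{v} C] [Preadditive C] [Limits.HasZeroObject C]
  [HasShift C ℤ] [∀ n : ℤ, (shiftFunctor C n).Additive] [Pretriangulated C]

section

open scoped ZeroObject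

variable {C}

/-- The middle-four interchange isomorphism for biproducts. -/
noncomputable def biprodInterchange (X Y Z W : C) : (X ⊞ Y) ⊞ (Z ⊞ W) ≅ (X ⊞ Z) ⊞ (Y ⊞ W) where
  hom := biprod.lift (biprod.map biprod.fst biprod.fst) (biprod.map biprod.snd biprod.snd)
  inv := biprod.lift (biprod.map biprod.fst biprod.fst) (biprod.map biprod.snd biprod.snd)

/-- The product over a two-element type is the binary biproduct. -/
noncomputable def piWalkingPairIsoBiprod (f : WalkingPair → C) :
    (∏ᶜ f) ≅ f WalkingPair.left ⊞ f WalkingPair.right where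
  hom := biprod.lift (Pi.π f WalkingPair.left) (Pi.π f WalkingPair.right)
  inv := Pi.lift fun
    | WalkingPair.left => biprod.fst
    | WalkingPair.right => biprod.snd
  hom_inv_id := by
    ext j
    cases j <;> simp
  inv_hom_id := by
    ext <;> simp

namespace IsTriangulatedSubcat

variable {S : Set C}

lemma obj₁_mem (hS : IsTriangulatedSubcat C S) (T : Triangle C) (hT : T ∈ distTriang C)
    (h₂ : T.obj₂ ∈ S) (h₃ : T.obj₃ ∈ S) : T.obj₁ ∈ S :=
  hS.mem_of_iso ((shiftEquiv C (1 : ℤ)).unitIso.app T.obj₁)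
    (hS.shift_neg_mem (hS.ext_mem _ (rot_of_distTriang _ hT) h₂ h₃))

lemma obj₂_mem (hS : IsTriangulatedSubcat C S) (T : Triangle C) (hT : T ∈ distTriang C)
    (h₁ : T.obj₁ ∈ S) (h₃ : T.obj₃ ∈ S) : T.obj₂ ∈ S :=
  hS.ext_mem _ (inv_rot_of_distTriang _ hT) (hS.shift_neg_mem h₃) h₁

lemma biprod_mem (hS : IsTriangulatedSubcat C S) {X Y : C} (hX : X ∈ S) (hY : Y ∈ S) :
    (X ⊞ Y) ∈ S :=
  hS.obj₂_mem _ (binaryBiproductTriangle_distinguished X Y) hX hY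

lemma mem_of_biprod_mem (hS : IsTriangulatedSubcat C S) {X Y : C} (hXY : (X ⊞ Y) ∈ S)
    (hY : Y ∈ S) : X ∈ S :=
  hS.obj₁_mem _ (binaryBiproductTriangle_distinguished X Y) hXY hY

/-- The middle vertex of a direct sum of two distinguished triangles lies in a triangulated
subcategory as soon as the two outer vertices do. -/
lemma biprod_obj₂_mem (hS : IsTriangulatedSubcat C S) (T T' : Triangle C)
    (hT : T ∈ distTriang C) (hT' : T' ∈ distTriang C)
    (h₁ : (T.obj₁ ⊞ T'.obj₁) ∈ S) (h₃ : (T.obj₃ ⊞ T'.obj₃) ∈ S) :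
    (T.obj₂ ⊞ T'.obj₂) ∈ S := by
  let F : WalkingPair → Triangle C := fun j => WalkingPair.casesOn j T T'
  have hF : productTriangle F ∈ distTriang C :=
    productTriangle_distinguished F (by rintro (_ | _) <;> assumption)
  exact hS.mem_of_iso (piWalkingPairIsoBiprod fun j => (F j).obj₂).symm
    (hS.obj₂_mem _ hF (hS.mem_of_iso (piWalkingPairIsoBiprod fun j => (F j).obj₁) h₁)
      (hS.mem_of_iso (piWalkingPairIsoBiprod fun j => (F j).obj₃) h₃))

/-- Two objects are equivalent modulo a dense triangulated subcategory if they have a common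
complement. -/
def complementSetoid (hS : IsTriangulatedSubcat C S) (hdense : DenseSub C S) : Setoid C where
  r X Y := ∃ W : C, (X ⊞ W) ∈ S ∧ (Y ⊞ W) ∈ S
  iseqv :=
    { refl := fun X => (hdense X).imp fun _ h => ⟨h, h⟩
      symm := fun ⟨W, hX, hY⟩ => ⟨W, hY, hX⟩
      trans := by
        rintro X Y Z ⟨W, hX, hY⟩ ⟨W', hY', hZ⟩
        refine ⟨W ⊞ (Y ⊞ W'), hS.mem_of_iso (biprod.associator _ _ _).symm
          (hS.biprod_mem hX hY'), hS.mem_of_iso ?_ (hS.biprod_mem hY hZ)⟩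
        exact (biprod.associator _ _ _).symm ≪≫ biprod.mapIso (biprod.braiding _ _) (Iso.refl _) ≪≫
          biprodInterchange _ _ _ _ ≪≫
            biprod.mapIso (biprod.braiding _ _) (Iso.refl _) }

/-- The group of objects modulo a dense triangulated subcategory. -/
def ComplementQuotient (hS : IsTriangulatedSubcat C S) (hdense : DenseSub C S) : Type u :=
  Quotient (hS.complementSetoid hdense)

namespace ComplementQuotient

/-- The class of an object modulo a dense triangulated subcategory. -/
def mk (hS : IsTriangulatedSubcat C S) (hdense : DenseSub C S) (X : C) :
    hS.ComplementQuotient hdense :=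
  Quotient.mk _ X

variable {hS : IsTriangulatedSubcat C S} {hdense : DenseSub C S}

lemma mk_eq_of_mem {X Y W : C} (hX : (X ⊞ W) ∈ S) (hY : (Y ⊞ W) ∈ S) :
    mk hS hdense X = mk hS hdense Y :=
  Quotient.sound ⟨W, hX, hY⟩

lemma mk_eq_of_iso {X Y : C} (e : X ≅ Y) : mk hS hdense X = mk hS hdense Y := by
  obtain ⟨W, hW⟩ := hdense Y
  exact mk_eq_of_mem (hS.mem_of_iso (biprod.mapIso e (Iso.refl W)) hW) hW

noncomputable instance : Add (hS.ComplementQuotient hdense) where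
  add := Quotient.map₂ (fun X Y => X ⊞ Y) (by
    rintro X X' ⟨W, hX, hX'⟩ Y Y' ⟨Z, hY, hY'⟩
    exact ⟨W ⊞ Z, hS.mem_of_iso (biprodInterchange _ _ _ _) (hS.biprod_mem hX hY),
      hS.mem_of_iso (biprodInterchange _ _ _ _) (hS.biprod_mem hX' hY')⟩)

noncomputable instance : Zero (hS.ComplementQuotient hdense) := ⟨mk hS hdense 0⟩

noncomputable instance : Neg (hS.ComplementQuotient hdense) :=
  ⟨fun q => mk hS hdense (hdense (Quotient.out q)).choose⟩

lemma mk_biprod (X Y : C) : mk hS hdense (X ⊞ Y) = mk hS hdense X + mk hS hdense Y := rfl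

lemma mk_eq_zero_iff {X : C} : mk hS hdense X = 0 ↔ X ∈ S := by
  constructor
  · intro h
    obtain ⟨W, hX, hW⟩ := Quotient.exact h
    exact hS.mem_of_biprod_mem hX (hS.mem_of_iso (isoZeroBiprod (isZero_zero C)) hW)
  · intro h
    exact mk_eq_of_mem (hS.biprod_mem h h)
      (hS.mem_of_iso (isoZeroBiprod (isZero_zero C)).symm h)

lemma zero_add_mk (X : C) : 0 + mk hS hdense X = mk hS hdense X :=
  (mk_eq_of_iso (isoZeroBiprod (isZero_zero C))).symm

lemma mk_add_comm (X Y : C) :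
    mk hS hdense X + mk hS hdense Y = mk hS hdense Y + mk hS hdense X :=
  mk_eq_of_iso (biprod.braiding X Y)

noncomputable instance : AddCommGroup (hS.ComplementQuotient hdense) where
  add_assoc := by
    rintro ⟨X⟩ ⟨Y⟩ ⟨Z⟩
    exact mk_eq_of_iso (biprod.associator X Y Z)
  zero_add := by
    rintro ⟨X⟩
    exact zero_add_mk X
  add_zero := by
    rintro ⟨X⟩
    exact (mk_add_comm X 0).trans (zero_add_mk X)
  add_comm := by
    rintro ⟨X⟩ ⟨Y⟩
    exact mk_add_comm X Y
  neg_add_cancel q := by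
    have h : mk hS hdense (Quotient.out q) = q := Quotient.out_eq q
    nth_rewrite 2 [← h]
    exact (mk_add_comm _ _).trans
      (mk_eq_zero_iff.mpr (hdense (Quotient.out q)).choose_spec)
  nsmul := nsmulRec
  zsmul := zsmulRec

lemma mk_obj₂ (T : Triangle C) (hT : T ∈ distTriang C) :
    mk hS hdense T.obj₂ = mk hS hdense T.obj₁ + mk hS hdense T.obj₃ := by
  obtain ⟨X, hX⟩ := hdense T.obj₁
  obtain ⟨Z, hZ⟩ := hdense T.obj₃
  rw [← mk_biprod]
  exact mk_eq_of_mem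
    (hS.biprod_obj₂_mem T _ hT (binaryBiproductTriangle_distinguished X Z) hX hZ)
    (hS.mem_of_iso (biprodInterchange _ _ _ _) (hS.biprod_mem hX hZ))

lemma mk_npowAux (X : C) (n : ℕ) :
    mk hS hdense (npowAux C X n) = (n + 1) • mk hS hdense X := by
  induction n with
  | zero => simp [npowAux]
  | succ n ih => rw [npowAux, mk_biprod, ih, succ_nsmul' _ (n + 1)]

/-- The homomorphism from the Grothendieck group sending the class of an object to its class
modulo a dense triangulated subcategory. -/
noncomputable def ofG (hS : IsTriangulatedSubcat C S) (hdense : DenseSub C S) :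
    G C →+ hS.ComplementQuotient hdense :=
  QuotientAddGroup.lift (eulerSubgroup C) (FreeAbelianGroup.lift (mk hS hdense)) (by
    rw [eulerSubgroup, AddSubgroup.closure_le]
    rintro _ ⟨T, hT, rfl⟩
    simp [mk_obj₂ T hT])

lemma ofG_cls (X : C) : ofG hS hdense (cls C X) = mk hS hdense X :=
  FreeAbelianGroup.lift_apply_of _ _

end ComplementQuotient

end IsTriangulatedSubcat

end

/-- if `D` is a radical dense subcategory of `C` and `[U]` is a torsion
element of `G(C)`, then `U ∈ D`. -/
theorem mem_radical_dense_of_torsion (S : Set C) (hS : IsTriangulatedSubcat C S)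
    (hdense : DenseSub C S) (hrad : RadicalSub C S) (U : C)
    (htor : ∃ n : ℕ, 0 < n ∧ n • cls C U = 0) : U ∈ S := by
  obtain ⟨n, hn, h⟩ := htor
  refine hrad U n hn ((IsTriangulatedSubcat.ComplementQuotient.mk_eq_zero_iff (hS := hS)
    (hdense := hdense)).mp ?_)
  rw [npow, IsTriangulatedSubcat.ComplementQuotient.mk_npowAux, Nat.sub_add_cancel hn,
    ← IsTriangulatedSubcat.ComplementQuotient.ofG_cls, ← map_nsmul, h, map_zero]


end GrothendieckPaper
end
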